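/- arXiv:math/0105043 — 3 statements merged into one kernel-verified Lean document; each statement's English description precedes it below -/
import Mathlib

section
/- Let λ ∈ ℝ and let b > 0 satisfy b³ − λ·b > 1. Let k be an even integer, set I_k = [(2k−1)π/2, (2k+1)π/2], and let J_k and M_k be closed intervals with M_k contained in the interior of J_k and J_k ⊆ I_k. Then for every δ > 0 there exists ε₀ > 0 such that for every ε ∈ (0, ε₀) and every solution u of (∗) on J_k with −b ≤ u(t) ≤ 0 for all t ∈ J_k, one has |u(t) − U̲(t)| < δ for all t ∈ M_k. Similarly, if k is odd and u is a solution of (∗) on J_k with 0 ≤ u(t) ≤ b on J_k, then |u(t) − Ū(t)| < δ for all t ∈ M_k. -/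
open Real Set

/-- Weak maximum principle: a function which is strictly convex wherever it is positive, and
nonpositive at the ends of an interval, is nonpositive on the interval. -/
theorem nonpos_of_deriv_deriv_pos_of_pos {w : ℝ → ℝ} (hw : Continuous w) {p q : ℝ}
    (hp : w p ≤ 0) (hq : w q ≤ 0)
    (hconv : ∀ t ∈ Icc p q, 0 < w t → 0 < deriv (deriv w) t) :
    ∀ t ∈ Icc p q, w t ≤ 0 := by
  intro t ht
  by_contra! hpos
  obtain ⟨s, hs, hmax⟩ := isCompact_Icc.exists_isMaxOn ⟨t, ht⟩ hw.continuousOn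
  have hspos : 0 < w s := hpos.trans_le (hmax ht)
  have hsp : p < s := lt_of_le_of_ne hs.1 (by rintro rfl; linarith)
  have hsq : s < q := lt_of_le_of_ne hs.2 (by rintro rfl; linarith)
  have hlmax : IsLocalMax w s := hmax.isLocalMax (Icc_mem_nhds hsp hsq)
  have hdd := hconv s hs hspos
  have hlmin : IsLocalMin w s :=
    isLocalMin_of_deriv_deriv_pos hdd hlmax.deriv_eq_zero hw.continuousAt
  have hconst : w =ᶠ[nhds s] fun _ => w s := by
    filter_upwards [hlmax, hlmin] with r h₁ h₂ using le_antisymm h₁ h₂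
  rw [hconst.deriv.deriv_eq] at hdd
  simp at hdd

/-- A function bounded by `a + B` at distance `η` from `t₀`, and with second derivative larger than
`2 * B / η ^ 2` wherever it exceeds `a`, is at most `a` at `t₀`. -/
theorem le_of_lt_deriv_deriv {u : ℝ → ℝ} (hu : ContDiff ℝ 2 u) {t₀ η a B : ℝ} (hη : 0 < η)
    (hB : 0 ≤ B) (hl : u (t₀ - η) ≤ a + B) (hr : u (t₀ + η) ≤ a + B)
    (hconv : ∀ t ∈ Icc (t₀ - η) (t₀ + η), a < u t → 2 * B / η ^ 2 < deriv (deriv u) t) :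
    u t₀ ≤ a := by
  have hφ : ∀ t, HasDerivAt (fun t => a + B / η ^ 2 * (t - t₀) ^ 2)
      (B / η ^ 2 * (2 * (t - t₀))) t := fun t => by
    have h := ((((hasDerivAt_id t).sub_const t₀).pow 2).const_mul (B / η ^ 2)).const_add a
    simpa using h
  have hφ' : ∀ t, HasDerivAt (fun t => B / η ^ 2 * (2 * (t - t₀))) (2 * B / η ^ 2) t := fun t => by
    have h := (((hasDerivAt_id t).sub_const t₀).const_mul 2).const_mul (B / η ^ 2)
    exact h.congr_deriv (by ring)
  have hdu : Differentiable ℝ u := hu.differentiable (by norm_num)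
  have hddu : Differentiable ℝ (deriv u) := (hu.deriv' (n := 1)).differentiable (by norm_num)
  set w : ℝ → ℝ := fun t => u t - (a + B / η ^ 2 * (t - t₀) ^ 2) with hwdef
  have hw' : deriv w = fun t => deriv u t - B / η ^ 2 * (2 * (t - t₀)) :=
    funext fun t => ((hdu t).hasDerivAt.sub (hφ t)).deriv
  have hw'' : ∀ t, deriv (deriv w) t = deriv (deriv u) t - 2 * B / η ^ 2 := fun t => by
    rw [hw']
    exact ((hddu t).hasDerivAt.sub (hφ' t)).deriv
  have hcont : Continuous w := by
    have := hu.continuous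
    fun_prop
  have hη2 : B / η ^ 2 * η ^ 2 = B := div_mul_cancel₀ _ (by positivity)
  have key := nonpos_of_deriv_deriv_pos_of_pos hcont (p := t₀ - η) (q := t₀ + η)
    (by simp only [hwdef, sub_sub_cancel_left, neg_sq, hη2]; linarith)
    (by simp only [hwdef, add_sub_cancel_left, hη2]; linarith)
    (fun t ht hpos => by
      have h0 : 0 ≤ B / η ^ 2 * (t - t₀) ^ 2 := by positivity
      rw [hw'']
      exact sub_pos.2 (hconv t ht (by simp only [hwdef] at hpos; linarith)))
    t₀ ⟨by linarith, by linarith⟩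
  simp only [hwdef, sub_self] at key
  linarith

/-- The least root of `x ^ 3 - lam * x + r` is negative when `r > 0`, provided the cubic is
nonpositive somewhere on the negative axis. -/
theorem least_root_neg {lam b r x : ℝ} (hb : 0 < b) (hr : 0 < r) (hbr : r ≤ b ^ 3 - lam * b)
    (hx : x ^ 3 - lam * x + r = 0) (hmin : ∀ y : ℝ, y ^ 3 - lam * y + r = 0 → x ≤ y) : x < 0 := by
  have hcont : ContinuousOn (fun y : ℝ => y ^ 3 - lam * y + r) (Icc (-b) 0) := by fun_prop
  obtain ⟨y, hy, hy0⟩ := intermediate_value_Icc (by linarith) hcont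
    (show (0 : ℝ) ∈ Icc _ _ from ⟨by nlinarith, by simpa using hr.le⟩)
  refine lt_of_le_of_ne ((hmin y hy0).trans hy.2) ?_
  rintro rfl
  simp at hx
  linarith

/-- The cubic `y ^ 3 - lam * y + r` with a negative root `x` is, on the negative axis, `y - x` times
a factor bounded below. -/
theorem exists_cubic_factor {lam b c r x : ℝ} (hb : 0 < b) (hc : 0 < c) (hcr : c ≤ r)
    (hbr : r < b ^ 3 - lam * b) (hx : x ^ 3 - lam * x + r = 0) (hx0 : x < 0) :
    -b < x ∧ ∀ y ≤ 0, ∃ s, c / b ≤ s ∧ y ^ 3 - lam * y + r = (y - x) * s := by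
  have hxne : x ≠ 0 := hx0.ne
  have hlam : lam = x ^ 2 - r / (-x) := by
    field_simp
    linarith
  have hfac : ∀ y, y ^ 3 - lam * y + r = (y - x) * (y ^ 2 + x * y + r / (-x)) := fun y => by
    rw [hlam]
    field_simp
    ring
  have hrx : 0 < r / (-x) := div_pos (hc.trans_le hcr) (by linarith)
  have hbx : -b < x := by
    have h := hfac (-b)
    have hs : 0 < (-b) ^ 2 + x * (-b) + r / (-x) := by nlinarith [mul_pos hb (neg_pos.2 hx0)]
    have : ((-b) - x) * ((-b) ^ 2 + x * (-b) + r / (-x)) < 0 := by rw [← h]; nlinarith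
    have := neg_of_mul_neg_left this hs.le
    linarith
  refine ⟨hbx, fun y hy => ⟨_, ?_, hfac y⟩⟩
  have h1 : c / b ≤ r / (-x) := div_le_div₀ (hc.le.trans hcr) hcr (by linarith) (by linarith)
  nlinarith [mul_nonneg_of_nonpos_of_nonpos hx0.le hy, sq_nonneg y]

/-- Solutions of `ε ^ 2 * u'' = u ^ 3 - lam * u + h` with values in `[-b, 0]` are, for small `ε`,
close to the least root of the cubic on intervals where the forcing `h` is positive. -/
theorem abs_sub_least_root_lt {lam b : ℝ} (hb : 0 < b) (hb3 : 1 < b ^ 3 - lam * b) {h : ℝ → ℝ}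
    (hLip : ∀ s t, |h s - h t| ≤ |s - t|) (h1 : ∀ t, h t ≤ 1) {j₁ j₂ m₁ m₂ : ℝ}
    (hMJ1 : j₁ < m₁) (hMJ2 : m₂ < j₂) (hm : m₁ ≤ m₂) (hpos : ∀ t ∈ Icc m₁ m₂, 0 < h t)
    {δ : ℝ} (hδ : 0 < δ) :
    ∃ ε₀ > (0 : ℝ), ∀ ε : ℝ, 0 < ε → ε < ε₀ → ∀ u : ℝ → ℝ, ContDiff ℝ 2 u →
      (∀ t ∈ Icc j₁ j₂, ε ^ 2 * deriv (deriv u) t = u t ^ 3 - lam * u t + h t) →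
      (∀ t ∈ Icc j₁ j₂, -b ≤ u t ∧ u t ≤ 0) →
      ∀ t ∈ Icc m₁ m₂, ∀ x : ℝ, (x ^ 3 - lam * x + h t = 0 ∧
        ∀ y : ℝ, y ^ 3 - lam * y + h t = 0 → x ≤ y) → |u t - x| < δ := by
  have hcont : Continuous h := (LipschitzWith.of_dist_le_mul (K := 1) fun s t => by
    simpa [Real.dist_eq] using hLip s t).continuous
  obtain ⟨τ, hτ, hτmin⟩ := isCompact_Icc.exists_isMinOn (nonempty_Icc.2 hm) hcont.continuousOn
  set c := h τ with hcdef
  have hc : 0 < c := hpos τ hτ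
  have hcb : 0 < c / b := div_pos hc hb
  obtain ⟨η, hη, hηlt⟩ : ∃ η > 0, η < min (c / b * (δ / 4)) (min (m₁ - j₁) (j₂ - m₂)) :=
    exists_between (lt_min (by positivity) (lt_min (by linarith) (by linarith)))
  obtain ⟨hη1, hη2, hη3⟩ : η < c / b * (δ / 4) ∧ η < m₁ - j₁ ∧ η < j₂ - m₂ := by
    simpa [lt_min_iff] using hηlt
  refine ⟨√(c / b * (δ / 4) / (2 * b / η ^ 2)), by positivity, ?_⟩
  intro ε hε hε0 u hu hode hbd t₀ ht₀ x ⟨hx, hxmin⟩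
  have hεK : ε ^ 2 * (2 * b / η ^ 2) < c / b * (δ / 4) :=
    (lt_div_iff₀ (by positivity)).1 ((Real.lt_sqrt hε.le).1 hε0)
  have hε2 : 0 < ε ^ 2 := by positivity
  have hx0 : x < 0 := least_root_neg hb (hpos t₀ ht₀) ((h1 t₀).trans hb3.le) hx hxmin
  obtain ⟨hbx, hfac⟩ := exists_cubic_factor hb hc (hτmin ht₀) ((h1 t₀).trans_lt hb3) hx hx0
  have hsub : ∀ t ∈ Icc (t₀ - η) (t₀ + η), t ∈ Icc j₁ j₂ := fun t ht =>
    ⟨by linarith [ht.1, ht₀.1], by linarith [ht.2, ht₀.2]⟩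
  have hL : ∀ t ∈ Icc (t₀ - η) (t₀ + η), |h t - h t₀| ≤ η := fun t ht =>
    (hLip t t₀).trans (abs_le.2 ⟨by linarith [ht.1], by linarith [ht.2]⟩)
  have hleft := hbd _ (hsub (t₀ - η) ⟨le_rfl, by linarith⟩)
  have hright := hbd _ (hsub (t₀ + η) ⟨by linarith, le_rfl⟩)
  have upper : u t₀ ≤ x + δ / 2 := by
    refine le_of_lt_deriv_deriv hu hη hb.le (by linarith) (by linarith) fun t ht hut => ?_
    obtain ⟨s, hs, hfs⟩ := hfac (u t) (hbd t (hsub t ht)).2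
    have hmul : c / b * (δ / 2) ≤ (u t - x) * s := by
      rw [mul_comm]
      exact mul_le_mul (by linarith) hs hcb.le (by linarith)
    refine lt_of_mul_lt_mul_left ?_ hε2.le
    rw [hode t (hsub t ht)]
    linarith [(abs_le.1 (hL t ht)).1]
  have lower : -u t₀ ≤ -x + δ / 2 := by
    refine le_of_lt_deriv_deriv (u := fun t => -u t) hu.neg hη hb.le (by linarith) (by linarith)
      fun t ht hut => ?_
    obtain ⟨s, hs, hfs⟩ := hfac (u t) (hbd t (hsub t ht)).2
    have hmul : c / b * (δ / 2) ≤ (x - u t) * s := by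
      rw [mul_comm]
      exact mul_le_mul (by linarith) hs hcb.le (by linarith)
    refine lt_of_mul_lt_mul_left ?_ hε2.le
    simp only [deriv.fun_neg', deriv.fun_neg]
    rw [mul_neg, hode t (hsub t ht)]
    linarith [(abs_le.1 (hL t ht)).2]
  exact abs_lt.2 ⟨by linarith, by linarith⟩

/-- Layer lemma: fix `λ` and `b > 0` with `b³ − λb > 1`; let `k` be an integer,
`I_k = [(2k−1)π/2, (2k+1)π/2]`, and let `J_k = [j₁,j₂] ⊆ I_k`,
`M_k = [m₁,m₂] ⊆ int(J_k)` be closed intervals.  Then for every `δ > 0` there is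
`ε₀ > 0` such that for `0 < ε < ε₀` and any solution `u` of the Duffing equation
on `J_k`: if `k` is even and `−b ≤ u ≤ 0` on `J_k`, then `u` is `δ`-close on
`M_k` to the least root `U̲(t)` of `x³ − λx + cos t = 0`; if `k` is odd and
`0 ≤ u ≤ b` on `J_k`, then `u` is `δ`-close on `M_k` to the greatest root `Ū(t)`. -/
theorem stmt_11 (lam b : ℝ) (hb : 0 < b) (hb3 : 1 < b ^ 3 - lam * b)
    (k : ℤ) (j₁ j₂ m₁ m₂ : ℝ)
    (hJI1 : (2 * (k : ℝ) - 1) * π / 2 ≤ j₁) (hJI2 : j₂ ≤ (2 * (k : ℝ) + 1) * π / 2)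
    (hMJ1 : j₁ < m₁) (hMJ2 : m₂ < j₂) (hm : m₁ ≤ m₂) :
    ∀ δ > (0 : ℝ), ∃ ε₀ > (0 : ℝ), ∀ ε : ℝ, 0 < ε → ε < ε₀ →
      ∀ u : ℝ → ℝ, ContDiff ℝ 2 u →
        (∀ t ∈ Icc j₁ j₂,
          ε ^ 2 * deriv (deriv u) t = u t ^ 3 - lam * u t + Real.cos t) →
        (Even k → (∀ t ∈ Icc j₁ j₂, -b ≤ u t ∧ u t ≤ 0) →
          ∀ t ∈ Icc m₁ m₂, ∀ x : ℝ,
            (x ^ 3 - lam * x + Real.cos t = 0 ∧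
              ∀ y : ℝ, y ^ 3 - lam * y + Real.cos t = 0 → x ≤ y) →
            |u t - x| < δ) ∧
        (Odd k → (∀ t ∈ Icc j₁ j₂, 0 ≤ u t ∧ u t ≤ b) →
          ∀ t ∈ Icc m₁ m₂, ∀ x : ℝ,
            (x ^ 3 - lam * x + Real.cos t = 0 ∧
              ∀ y : ℝ, y ^ 3 - lam * y + Real.cos t = 0 → y ≤ x) →
            |u t - x| < δ) := by
  intro δ hδ
  have hLip : ∀ s t, |Real.cos s - Real.cos t| ≤ |s - t| := fun s t => by
    simpa [Real.dist_eq] using Real.lipschitzWith_cos.dist_le_mul s t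
  rcases Int.even_or_odd k with hk | hk
  · have hpos : ∀ t ∈ Icc m₁ m₂, 0 < Real.cos t := fun t ht => by
      obtain ⟨n, rfl⟩ := hk
      push_cast at hJI1 hJI2
      rw [← Real.cos_sub_int_mul_two_pi t n]
      exact Real.cos_pos_of_mem_Ioo ⟨by linarith [ht.1], by linarith [ht.2]⟩
    obtain ⟨ε₀, hε₀, H⟩ :=
      abs_sub_least_root_lt hb hb3 hLip Real.cos_le_one hMJ1 hMJ2 hm hpos hδ
    exact ⟨ε₀, hε₀, fun ε hε hε' u hu hode =>
      ⟨fun _ => H ε hε hε' u hu hode, fun hk' => absurd hk (Int.not_even_iff_odd.2 hk')⟩⟩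
  · have hpos : ∀ t ∈ Icc m₁ m₂, 0 < -Real.cos t := fun t ht => by
      obtain ⟨n, rfl⟩ := hk
      push_cast at hJI1 hJI2
      rw [← Real.cos_sub_int_mul_two_pi t n, ← Real.cos_sub_pi]
      exact Real.cos_pos_of_mem_Ioo ⟨by linarith [ht.1], by linarith [ht.2]⟩
    obtain ⟨ε₀, hε₀, H⟩ := abs_sub_least_root_lt (h := fun t => -Real.cos t) hb hb3
      (fun s t => by rw [neg_sub_neg, abs_sub_comm]; exact hLip s t)
      (fun t => by linarith [Real.neg_one_le_cos t]) hMJ1 hMJ2 hm hpos hδ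
    refine ⟨ε₀, hε₀, fun ε hε hε' u hu hode =>
      ⟨fun hk' => absurd hk (Int.not_odd_iff_even.2 hk'), fun _ hbd t ht x hx => ?_⟩⟩
    have key := H ε hε hε' (fun t => -u t) hu.neg
      (fun t ht => by
        simp only [deriv.fun_neg', deriv.fun_neg]
        linear_combination -hode t ht)
      (fun t ht => ⟨by linarith [(hbd t ht).2], by linarith [(hbd t ht).1]⟩) t ht (-x)
      ⟨by linear_combination -hx.1, fun y hy => by
        linarith [hx.2 (-y) (by linear_combination -hy)]⟩
    rwa [neg_sub_neg, abs_sub_comm] at key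
end

section
/- Let λ > λ₀ and set K := √(Ū(0) − √(λ/3)). There exist M₀ > 0 and ε₀ ∈ (0, 1) such that for every ε ∈ (0, ε₀] the following holds: if u is a solution of (∗) defined and bounded on all of ℝ, and c < d are reals with u(t) < −√(λ/3) for all t ∈ [c, d], then |u(t) − U̲(t)| < M₀·ε² for every t ∈ [c + (3/K)·ε·|ln ε|, d − (3/K)·ε·|ln ε|]; and if instead u(t) > √(λ/3) for all t ∈ [c, d], then |u(t) − Ū(t)| < M₀·ε² for every t in the same subinterval. -/
open Real Set

/-- Maximum principle: a function that is nonpositive at both ends of an interval and strictly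
convex wherever it is positive is nonpositive throughout. -/
theorem nonpos_of_deriv_deriv_pos {z : ℝ → ℝ} {a b : ℝ} (hz : Continuous z)
    (ha : z a ≤ 0) (hb : z b ≤ 0)
    (hpos : ∀ t ∈ Ioo a b, 0 < z t → 0 < deriv (deriv z) t) :
    ∀ t ∈ Icc a b, z t ≤ 0 := by
  intro t ht
  by_contra! hzt
  obtain ⟨m, hm, hmax⟩ := isCompact_Icc.exists_isMaxOn ⟨t, ht⟩ hz.continuousOn
  have hzm : 0 < z m := hzt.trans_le (hmax ht)
  have hma : a ≠ m := fun h => by rw [h] at ha; linarith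
  have hmb : m ≠ b := fun h => by rw [← h] at hb; linarith
  have hmI : m ∈ Ioo a b := ⟨lt_of_le_of_ne hm.1 hma, lt_of_le_of_ne hm.2 hmb⟩
  have hloc : IsLocalMax z m := hmax.isLocalMax (Icc_mem_nhds hmI.1 hmI.2)
  have h2 := hpos m hmI hzm
  have hmin : IsLocalMin z m :=
    isLocalMin_of_deriv_deriv_pos h2 hloc.deriv_eq_zero hz.continuousAt
  have hconst : z =ᶠ[nhds m] fun _ => z m := by
    filter_upwards [hloc, hmin] with x hx hx' using le_antisymm hx hx'
  have h0 := hconst.deriv.deriv_eq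
  simp at h0
  linarith

theorem deriv_deriv_sub {f g : ℝ → ℝ} (hf : ContDiff ℝ 2 f) (hg : ContDiff ℝ 2 g) (t : ℝ) :
    deriv (deriv fun x => f x - g x) t = deriv (deriv f) t - deriv (deriv g) t := by
  have h1 : deriv (fun x => f x - g x) = fun x => deriv f x - deriv g x := by
    ext x
    exact deriv_fun_sub (hf.differentiable (by norm_num) x) (hg.differentiable (by norm_num) x)
  rw [h1]
  exact deriv_fun_sub (hf.differentiable_deriv_two t) (hg.differentiable_deriv_two t)

theorem deriv_deriv_quadratic (R η t₀ t : ℝ) :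
    deriv (deriv fun x => R + η * (x - t₀) ^ 2) t = 2 * η := by
  have h1 : deriv (fun x => R + η * (x - t₀) ^ 2) = fun x => 2 * η * (x - t₀) := by
    ext x
    have := (((hasDerivAt_id x).sub_const t₀).pow 2).const_mul η |>.const_add R
    refine (this.congr_deriv ?_).deriv
    simp
    ring
  rw [h1]
  simp

theorem deriv_deriv_exp_barrier (A N k c d t : ℝ) :
    deriv (deriv fun x => A + N * (exp (-k * (x - c)) + exp (-k * (d - x)))) t =
      k ^ 2 * (N * (exp (-k * (t - c)) + exp (-k * (d - t)))) := by
  have e1 (x : ℝ) : HasDerivAt (fun x => exp (-k * (x - c))) (-k * exp (-k * (x - c))) x := by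
    refine ((((hasDerivAt_id x).sub_const c).const_mul (-k)).exp).congr_deriv ?_
    simp
    ring
  have e2 (x : ℝ) : HasDerivAt (fun x => exp (-k * (d - x))) (k * exp (-k * (d - x))) x := by
    refine ((((hasDerivAt_id x).const_sub d).const_mul (-k)).exp).congr_deriv ?_
    simp
    ring
  have h1 : deriv (fun x => A + N * (exp (-k * (x - c)) + exp (-k * (d - x)))) =
      fun x => N * (-k * exp (-k * (x - c)) + k * exp (-k * (d - x))) := by
    ext x
    exact ((((e1 x).add (e2 x)).const_mul N).const_add A).deriv
  rw [h1]
  have := (((e1 t).const_mul (-k)).add ((e2 t).const_mul k)).const_mul N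
  refine (this.congr_deriv ?_).deriv
  ring

/-- A bounded global solution of the Duffing equation is bounded above by `λ + 1`. -/
theorem duffing_bounded_le {lam ε : ℝ} (hlam : 0 < lam) (hε : 0 < ε) {u : ℝ → ℝ}
    (hu : ContDiff ℝ 2 u)
    (hode : ∀ t : ℝ, ε ^ 2 * deriv (deriv u) t = u t ^ 3 - lam * u t + cos t)
    {M : ℝ} (hM : ∀ t : ℝ, |u t| ≤ M) (t₀ : ℝ) : u t₀ ≤ lam + 1 := by
  set η : ℝ := lam / (4 * ε ^ 2) with hη
  have hη0 : 0 < η := by positivity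
  have hM0 : 0 ≤ M := (abs_nonneg _).trans (hM t₀)
  obtain ⟨T, hT0, hT⟩ : ∃ T : ℝ, 0 ≤ T ∧ M ≤ η * T ^ 2 := by
    refine ⟨√(M / η), sqrt_nonneg _, ?_⟩
    rw [sq_sqrt (by positivity)]
    field_simp
    exact le_rfl
  have hg : ContDiff ℝ 2 fun x : ℝ => lam + 1 + η * (x - t₀) ^ 2 := by fun_prop
  have key := nonpos_of_deriv_deriv_pos (z := fun x => u x - (lam + 1 + η * (x - t₀) ^ 2))
    (a := t₀ - T) (b := t₀ + T) (hu.continuous.sub hg.continuous) ?_ ?_ ?_ t₀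
    ⟨by linarith, by linarith⟩
  · simp at key
    linarith
  · have := (abs_le.1 (hM (t₀ - T))).2
    ring_nf at this hT ⊢
    linarith
  · have := (abs_le.1 (hM (t₀ + T))).2
    ring_nf at this hT ⊢
    linarith
  · intro t _ ht
    rw [deriv_deriv_sub hu hg, deriv_deriv_quadratic]
    have hut : lam + 1 < u t := by
      have : 0 ≤ η * (t - t₀) ^ 2 := by positivity
      linarith
    have h1 := hode t
    have h2 : lam < u t ^ 3 - lam * u t + cos t := by
      have hc := neg_one_le_cos t
      have h3 : u t * (lam + 1) ≤ u t * (u t ^ 2 - lam) :=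
        mul_le_mul_of_nonneg_left (by nlinarith) (by linarith)
      nlinarith
    have h4 : ε ^ 2 * (2 * η) = lam / 2 := by
      rw [hη]
      field_simp
      norm_num
    have h5 : 0 < ε ^ 2 * (deriv (deriv u) t - 2 * η) := by
      rw [mul_sub, h4, h1]
      linarith
    exact pos_of_mul_pos_right h5 (by positivity)

/-- The greatest root of `x ^ 3 - 3 * s ^ 2 * x + cos t`, by the trigonometric formula. -/
noncomputable def upperRoot (s t : ℝ) : ℝ := 2 * s * cos (arccos (-cos t / (2 * s ^ 3)) / 3)

section upperRoot

variable {s : ℝ}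

theorem abs_cos_div_lt_one (hs : 0 < s) (hs1 : 1 < 2 * s ^ 3) (t : ℝ) :
    -1 < -cos t / (2 * s ^ 3) ∧ -cos t / (2 * s ^ 3) < 1 := by
  have h : 0 < 2 * s ^ 3 := by positivity
  have h1 := neg_one_le_cos t
  have h2 := cos_le_one t
  rw [lt_div_iff₀ h, div_lt_iff₀ h]
  constructor <;> linarith

theorem upperRoot_root (hs : 0 < s) (hs1 : 1 < 2 * s ^ 3) (t : ℝ) :
    upperRoot s t ^ 3 - 3 * s ^ 2 * upperRoot s t + cos t = 0 := by
  obtain ⟨h1, h2⟩ := abs_cos_div_lt_one hs hs1 t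
  set θ := arccos (-cos t / (2 * s ^ 3)) / 3 with hθ
  have h3 := cos_three_mul θ
  have h4 : 3 * θ = arccos (-cos t / (2 * s ^ 3)) := by rw [hθ]; ring
  rw [h4, cos_arccos h1.le h2.le, div_eq_iff (by positivity)] at h3
  have : upperRoot s t = 2 * s * cos θ := rfl
  rw [this]
  linear_combination -h3

theorem lt_upperRoot (hs : 0 < s) (hs1 : 1 < 2 * s ^ 3) (t : ℝ) : s < upperRoot s t := by
  obtain ⟨h1, h2⟩ := abs_cos_div_lt_one hs hs1 t
  have h3 : arccos (-cos t / (2 * s ^ 3)) < π := by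
    refine lt_of_le_of_ne (arccos_le_pi _) fun h => ?_
    rw [arccos_eq_pi] at h
    linarith
  have h4 := arccos_nonneg (-cos t / (2 * s ^ 3))
  have h5 : cos (π / 3) < cos (arccos (-cos t / (2 * s ^ 3)) / 3) :=
    cos_lt_cos_of_nonneg_of_le_pi (by linarith) (by linarith [pi_pos]) (by linarith)
  rw [cos_pi_div_three] at h5
  unfold upperRoot
  nlinarith

theorem upperRoot_le (hs : 0 < s) (t : ℝ) : upperRoot s t ≤ 2 * s :=
  mul_le_of_le_one_right (by linarith) (cos_le_one _)

theorem contDiff_upperRoot (hs : 0 < s) (hs1 : 1 < 2 * s ^ 3) : ContDiff ℝ 2 (upperRoot s) := by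
  have h : ContDiff ℝ 2 fun t => arccos (-cos t / (2 * s ^ 3)) := by
    rw [contDiff_iff_contDiffAt]
    intro t
    obtain ⟨h1, h2⟩ := abs_cos_div_lt_one hs hs1 t
    exact ContDiffAt.comp (g := arccos) t (contDiffAt_arccos h1.ne' h2.ne)
      (contDiff_cos.neg.div_const (2 * s ^ 3)).contDiffAt
  exact contDiff_const.mul (contDiff_cos.comp (h.div_const 3))

theorem exists_deriv_deriv_upperRoot_le (hs : 0 < s) (hs1 : 1 < 2 * s ^ 3) :
    ∃ V > 0, ∀ t, |deriv (deriv (upperRoot s)) t| ≤ V := by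
  have hper : Function.Periodic (upperRoot s) (2 * π) := fun t => by simp [upperRoot]
  have hder {f : ℝ → ℝ} (hf : Function.Periodic f (2 * π)) :
      Function.Periodic (deriv f) (2 * π) := fun t => by
    rw [← deriv_comp_add_const f (2 * π) t]
    exact congrArg (fun g => deriv g t) (funext hf)
  have hcont : Continuous (deriv (deriv (upperRoot s))) := by
    have h := (contDiff_upperRoot hs hs1).continuous_iteratedDeriv 2 le_rfl
    rwa [iteratedDeriv_succ, iteratedDeriv_one] at h
  obtain ⟨V, hV⟩ := isCompact_Icc.exists_bound_of_continuousOn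
    (s := Icc 0 (2 * π)) hcont.continuousOn
  refine ⟨max V 1, by positivity, fun t => ?_⟩
  obtain ⟨y, hy, hty⟩ := (hder (hder hper)).exists_mem_Ico₀ two_pi_pos t
  rw [hty]
  exact (hV y ⟨hy.1, hy.2.le⟩).trans (le_max_left _ _)

theorem eq_upperRoot (hs : 0 < s) (hs1 : 1 < 2 * s ^ 3) {t x : ℝ}
    (hx : x ^ 3 - 3 * s ^ 2 * x + cos t = 0)
    (hgreat : ∀ y : ℝ, y ^ 3 - 3 * s ^ 2 * y + cos t = 0 → y ≤ x) : x = upperRoot s t := by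
  have hr := upperRoot_root hs hs1 t
  have hlt := lt_upperRoot hs hs1 t
  have hle := hgreat _ hr
  set v := upperRoot s t
  have hq : 0 < x ^ 2 + x * v + v ^ 2 - 3 * s ^ 2 := by nlinarith
  have h0 : (x - v) * (x ^ 2 + x * v + v ^ 2 - 3 * s ^ 2) = 0 := by linear_combination hx - hr
  rcases mul_eq_zero.1 h0 with h | h <;> linarith

theorem upperRoot_zero_le (hs : 0 < s) (hs1 : 1 < 2 * s ^ 3) (t : ℝ) :
    upperRoot s 0 ≤ upperRoot s t := by
  have hr := upperRoot_root hs hs1 t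
  have hr0 := upperRoot_root hs hs1 0
  have hlt := lt_upperRoot hs hs1 t
  have hlt0 := lt_upperRoot hs hs1 0
  have hc := cos_le_one t
  rw [cos_zero] at hr0
  set v := upperRoot s t
  set w := upperRoot s 0
  by_contra! h
  have hq : 0 < w ^ 2 + w * v + v ^ 2 - 3 * s ^ 2 := by nlinarith
  have h0 : 0 < (w - v) * (w ^ 2 + w * v + v ^ 2 - 3 * s ^ 2) := mul_pos (by linarith) hq
  nlinarith

end upperRoot

/-- Exponential relaxation of a solution lying above `s` towards the greatest root. -/
theorem abs_sub_upperRoot_le {s ε K V N : ℝ} (hs : 0 < s) (hs1 : 1 < 2 * s ^ 3) (hε : 0 < ε)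
    (hK : 0 < K) (hK2 : K ^ 2 = upperRoot s 0 - s)
    (hV : ∀ t, |deriv (deriv (upperRoot s)) t| ≤ V) {u : ℝ → ℝ} (hu : ContDiff ℝ 2 u)
    (hode : ∀ t : ℝ, ε ^ 2 * deriv (deriv u) t = u t ^ 3 - 3 * s ^ 2 * u t + cos t)
    {c d : ℝ} (hgt : ∀ t ∈ Icc c d, s < u t)
    (hN : ∀ t ∈ Icc c d, |u t - upperRoot s t| ≤ N) :
    ∀ t ∈ Icc c d, |u t - upperRoot s t| ≤ V / K ^ 2 * ε ^ 2 +
      N * (exp (-(K / ε) * (t - c)) + exp (-(K / ε) * (d - t))) := by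
  intro t ht
  have hcd : c ≤ d := ht.1.trans ht.2
  have hN0 : 0 ≤ N := (abs_nonneg _).trans (hN t ht)
  have hV0 : 0 ≤ V := (abs_nonneg _).trans (hV t)
  have hv := contDiff_upperRoot hs hs1
  set B : ℝ → ℝ := fun t => V / K ^ 2 * ε ^ 2 +
      N * (exp (-(K / ε) * (t - c)) + exp (-(K / ε) * (d - t))) with hB
  have hBc : ContDiff ℝ 2 B := by
    rw [hB]
    fun_prop
  have hB0 (x : ℝ) : 0 ≤ B x := by
    simp only [hB]
    positivity
  have hB'' (x : ℝ) : ε ^ 2 * deriv (deriv B) x = K ^ 2 * B x - V * ε ^ 2 := by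
    rw [hB, deriv_deriv_exp_barrier]
    field_simp
    ring
  have hBl : N ≤ B c := by
    have : 0 ≤ V / K ^ 2 * ε ^ 2 := by positivity
    have : 0 ≤ N * exp (-(K / ε) * (d - c)) := by positivity
    simp only [hB, sub_self, mul_zero, exp_zero]
    linarith
  have hBr : N ≤ B d := by
    have : 0 ≤ V / K ^ 2 * ε ^ 2 := by positivity
    have : 0 ≤ N * exp (-(K / ε) * (d - c)) := by positivity
    simp only [hB, sub_self, mul_zero, exp_zero]
    linarith
  have hq {x : ℝ} (hx : x ∈ Icc c d) :
      K ^ 2 ≤ u x ^ 2 + u x * upperRoot s x + upperRoot s x ^ 2 - 3 * s ^ 2 := by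
    have h1 := hgt x hx
    have h2 := upperRoot_zero_le hs hs1 x
    have h3 := lt_upperRoot hs hs1 x
    have h4 : 1 ≤ 3 * s := by
      by_contra! h
      have : s ^ 3 ≤ 1 := pow_le_one₀ hs.le (by linarith)
      nlinarith [mul_pos hs hs]
    have h5 : (upperRoot s x - s) * 1 ≤ (upperRoot s x - s) * (upperRoot s x + 2 * s) :=
      mul_le_mul_of_nonneg_left (by linarith) (by linarith)
    nlinarith
  have heq (x : ℝ) : ε ^ 2 * deriv (deriv u) x = (u x - upperRoot s x) *
      (u x ^ 2 + u x * upperRoot s x + upperRoot s x ^ 2 - 3 * s ^ 2) := by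
    rw [hode x]
    linear_combination upperRoot_root hs hs1 x
  have hc := hN c (left_mem_Icc.2 hcd)
  have hd := hN d (right_mem_Icc.2 hcd)
  rw [abs_le] at hc hd ⊢
  constructor
  · have := nonpos_of_deriv_deriv_pos (z := fun x => (upperRoot s x - u x) - B x) (a := c) (b := d)
      ((hv.continuous.sub hu.continuous).sub hBc.continuous) (by linarith) (by linarith)
      (fun x hx hpos => ?_) t ht
    · simp only [hB] at this
      linarith
    · rw [deriv_deriv_sub (hv.sub hu) hBc, deriv_deriv_sub hv hu]
      have h1 := (abs_le.1 (hV x)).1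
      have h2 : (upperRoot s x - u x) * K ^ 2 ≤ _ :=
        mul_le_mul_of_nonneg_left (hq (Ioo_subset_Icc_self hx)) (by linarith [hB0 x])
      have h3 : 0 < K ^ 2 * (upperRoot s x - u x - B x) := by positivity
      have h4 : ε ^ 2 * (-V) ≤ ε ^ 2 * _ := mul_le_mul_of_nonneg_left h1 (by positivity)
      refine pos_of_mul_pos_right (a := ε ^ 2) ?_ (by positivity)
      linarith [hB'' x, heq x]
  · have := nonpos_of_deriv_deriv_pos (z := fun x => (u x - upperRoot s x) - B x) (a := c) (b := d)
      ((hu.continuous.sub hv.continuous).sub hBc.continuous) (by linarith) (by linarith)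
      (fun x hx hpos => ?_) t ht
    · simp only [hB] at this
      linarith
    · rw [deriv_deriv_sub (hu.sub hv) hBc, deriv_deriv_sub hu hv]
      have h1 := (abs_le.1 (hV x)).2
      have h2 : (u x - upperRoot s x) * K ^ 2 ≤ _ :=
        mul_le_mul_of_nonneg_left (hq (Ioo_subset_Icc_self hx)) (by linarith [hB0 x])
      have h3 : 0 < K ^ 2 * (u x - upperRoot s x - B x) := by positivity
      have h4 : ε ^ 2 * _ ≤ ε ^ 2 * V := mul_le_mul_of_nonneg_left h1 (by positivity)
      refine pos_of_mul_pos_right (a := ε ^ 2) ?_ (by positivity)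
      linarith [hB'' x, heq x]

theorem exp_neg_div_mul_le_sq {ε K τ : ℝ} (hε : 0 < ε) (hε1 : ε < 1) (hK : 0 < K)
    (hτ : 3 / K * ε * |log ε| ≤ τ) : exp (-(K / ε) * τ) ≤ ε ^ 2 := by
  have h1 : 2 * log ε = log (ε ^ 2) := by simp
  rw [← exp_log (pow_pos hε 2), ← h1]
  refine exp_le_exp.2 ?_
  have hl := log_neg hε hε1
  have h2 : K / ε * (3 / K * ε * |log ε|) ≤ K / ε * τ :=
    mul_le_mul_of_nonneg_left hτ (by positivity)
  have h3 : K / ε * (3 / K * ε * |log ε|) = 3 * |log ε| := by field_simp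
  rw [h3, abs_of_neg hl] at h2
  linarith

/-- The critical point of `x ^ 3 - λ x` has critical value of modulus above `1` when `λ > λ₀`. -/
theorem one_lt_two_mul_sqrt_pow {lam : ℝ} (hlam : (3 : ℝ) / (2 : ℝ) ^ ((2 : ℝ) / 3) < lam) :
    1 < 2 * √(lam / 3) ^ 3 := by
  have h0 : (0 : ℝ) < 2 ^ ((2 : ℝ) / 3) := by positivity
  have h1 : ((2 : ℝ) ^ ((2 : ℝ) / 3))⁻¹ < lam / 3 := by
    rw [div_eq_mul_inv] at hlam
    linarith
  have h2 : ((2 : ℝ) ^ ((2 : ℝ) / 3)) ^ 3 = 4 := by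
    rw [← rpow_natCast, ← rpow_mul (by norm_num)]
    norm_num
  have h3 : (1 : ℝ) / 4 < (lam / 3) ^ 3 := by
    have := pow_lt_pow_left₀ h1 (by positivity) (three_ne_zero)
    rw [inv_pow, h2] at this
    linarith
  have hl : 0 ≤ lam / 3 := (inv_nonneg.2 h0.le).trans h1.le
  have h4 : (√(lam / 3) ^ 3) ^ 2 = (lam / 3) ^ 3 := by
    rw [← pow_mul, mul_comm 3 2, pow_mul, sq_sqrt hl]
  have h5 : 0 ≤ √(lam / 3) ^ 3 := by positivity
  nlinarith

/-- Let `λ > λ₀ = 3/2^(2/3)` and `K = √(Ū(0) − √(λ/3))` where `Ū(0)` is the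
greatest root of `x³ − λx + 1 = 0`.  There are `M₀ > 0` and `ε₀ ∈ (0,1)` such
that for `0 < ε ≤ ε₀` and any bounded global solution `u` of the Duffing
equation: if `u < −√(λ/3)` on `[c,d]` then `|u − U̲| < M₀ε²` on
`[c + (3/K)ε|ln ε|, d − (3/K)ε|ln ε|]`, where `U̲(t)` is the least root of
`x³ − λx + cos t = 0`; similarly with `u > √(λ/3)` and the greatest root `Ū(t)`. -/
theorem stmt_12 (lam Ubar0 K : ℝ)
    (hlam : (3 : ℝ) / (2 : ℝ) ^ ((2 : ℝ) / 3) < lam)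
    (hUbar0root : Ubar0 ^ 3 - lam * Ubar0 + 1 = 0)
    (hUbar0great : ∀ y : ℝ, y ^ 3 - lam * y + 1 = 0 → y ≤ Ubar0)
    (hK : K = Real.sqrt (Ubar0 - Real.sqrt (lam / 3))) :
    ∃ M₀ > (0 : ℝ), ∃ ε₀ ∈ Ioo (0 : ℝ) 1, ∀ ε ∈ Ioc (0 : ℝ) ε₀,
      ∀ u : ℝ → ℝ, ContDiff ℝ 2 u →
        (∀ t : ℝ, ε ^ 2 * deriv (deriv u) t = u t ^ 3 - lam * u t + Real.cos t) →
        (∃ M : ℝ, ∀ t : ℝ, |u t| ≤ M) →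
        ∀ c d : ℝ, c < d →
          ((∀ t ∈ Icc c d, u t < -Real.sqrt (lam / 3)) →
            ∀ t ∈ Icc (c + 3 / K * ε * |Real.log ε|) (d - 3 / K * ε * |Real.log ε|),
              ∀ x : ℝ,
                (x ^ 3 - lam * x + Real.cos t = 0 ∧
                  ∀ y : ℝ, y ^ 3 - lam * y + Real.cos t = 0 → x ≤ y) →
                |u t - x| < M₀ * ε ^ 2) ∧
          ((∀ t ∈ Icc c d, Real.sqrt (lam / 3) < u t) →
            ∀ t ∈ Icc (c + 3 / K * ε * |Real.log ε|) (d - 3 / K * ε * |Real.log ε|),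
              ∀ x : ℝ,
                (x ^ 3 - lam * x + Real.cos t = 0 ∧
                  ∀ y : ℝ, y ^ 3 - lam * y + Real.cos t = 0 → y ≤ x) →
                |u t - x| < M₀ * ε ^ 2) := by
  have hs1 := one_lt_two_mul_sqrt_pow hlam
  have hlam0 : 0 < lam := lt_trans (by positivity) hlam
  set s := √(lam / 3) with hs_def
  have hs : 0 < s := sqrt_pos.2 (by positivity)
  have hls : lam = 3 * s ^ 2 := by
    rw [hs_def, sq_sqrt (by positivity)]
    ring
  have hU : Ubar0 = upperRoot s 0 := by
    apply eq_upperRoot hs hs1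
    · rwa [← hls, cos_zero]
    · rwa [← hls, cos_zero]
  have hU0 := lt_upperRoot hs hs1 0
  have hKpos : 0 < K := by
    rw [hK, hU]
    exact sqrt_pos.2 (by linarith)
  have hK2 : K ^ 2 = upperRoot s 0 - s := by
    rw [hK, hU, sq_sqrt (by linarith)]
  obtain ⟨V, hV0, hV⟩ := exists_deriv_deriv_upperRoot_le hs hs1
  set N := lam + 1 + 2 * s with hN_def
  have hN0 : 0 < N := by positivity
  set M₀ := V / K ^ 2 + 2 * N + 1 with hM₀
  have upper : ∀ ε ∈ Ioc (0 : ℝ) (1 / 2), ∀ u : ℝ → ℝ, ContDiff ℝ 2 u →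
      (∀ t : ℝ, ε ^ 2 * deriv (deriv u) t = u t ^ 3 - lam * u t + cos t) →
      (∃ M : ℝ, ∀ t : ℝ, |u t| ≤ M) → ∀ c d : ℝ, (∀ t ∈ Icc c d, s < u t) →
      ∀ t ∈ Icc (c + 3 / K * ε * |log ε|) (d - 3 / K * ε * |log ε|), ∀ x : ℝ,
        (x ^ 3 - lam * x + cos t = 0 ∧ ∀ y : ℝ, y ^ 3 - lam * y + cos t = 0 → y ≤ x) →
        |u t - x| < M₀ * ε ^ 2 := by
    rintro ε ⟨hε, hε2⟩ u hu hode ⟨M, hM⟩ c d hgt t ht x ⟨hx, hgreat⟩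
    have hN (t : ℝ) (ht : t ∈ Icc c d) : |u t - upperRoot s t| ≤ N := by
      have h1 := hgt t ht
      have h2 := duffing_bounded_le hlam0 hε hu hode hM t
      have h3 := lt_upperRoot hs hs1 t
      have h4 := upperRoot_le hs t
      rw [abs_le]
      constructor <;> linarith
    rw [hls] at hx hgreat
    have hxv := eq_upperRoot hs hs1 hx hgreat
    have hτ : 0 ≤ 3 / K * ε * |log ε| := by positivity
    have key := abs_sub_upperRoot_le hs hs1 hε hKpos hK2 hV hu (by rwa [← hls]) hgt hN t
      ⟨by linarith [ht.1], by linarith [ht.2]⟩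
    have e1 := exp_neg_div_mul_le_sq hε (by linarith) hKpos (τ := t - c) (by linarith [ht.1])
    have e2 := exp_neg_div_mul_le_sq hε (by linarith) hKpos (τ := d - t) (by linarith [ht.2])
    have e3 := mul_le_mul_of_nonneg_left (add_le_add e1 e2) hN0.le
    have e4 : 0 < ε ^ 2 := by positivity
    rw [hxv, hM₀]
    linarith
  refine ⟨M₀, by positivity, 1 / 2, ⟨by norm_num, by norm_num⟩, ?_⟩
  rintro ε hε u hu hode ⟨M, hM⟩ c d -
  refine ⟨fun hlt t ht x hx => ?_, upper ε hε u hu hode ⟨M, hM⟩ c d⟩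
  have hode' (r : ℝ) : ε ^ 2 * deriv (deriv fun r => -u (r + π)) r =
      (-u (r + π)) ^ 3 - lam * -u (r + π) + cos r := by
    have h1 : (deriv fun r => -u (r + π)) = fun r => -deriv u (r + π) := by
      ext r
      rw [deriv.fun_neg, deriv_comp_add_const]
    have h2 := hode (r + π)
    rw [cos_add_pi] at h2
    rw [h1, deriv.fun_neg, deriv_comp_add_const]
    linear_combination -h2
  have key := upper ε hε (fun r => -u (r + π)) (by fun_prop) hode'
    ⟨M, fun r => by simpa using hM (r + π)⟩ (c - π) (d - π)
    (fun r hr => by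
      have := hlt (r + π) ⟨by linarith [hr.1], by linarith [hr.2]⟩
      linarith)
    (t - π) ⟨by linarith [ht.1], by linarith [ht.2]⟩ (-x) ⟨?_, fun y hy => ?_⟩
  · have h : -u (t - π + π) - -x = -(u t - x) := by
      rw [sub_add_cancel]
      ring
    simpa only [h, abs_neg] using key
  · rw [cos_sub_pi]
    linear_combination -hx.1
  · rw [cos_sub_pi] at hy
    have := hx.2 (-y) (by linear_combination -hy)
    linarith
end

section
/- Let ε > 0 and λ ∈ ℝ, and let u be a solution of (∗) on [0, π] with u'(0) = 0. Suppose 0 < t₁ < t_m < t₂ < π with u'(t₁) = u'(t_m) = u'(t₂) = 0, and either (successive maxima case) u'(t) < 0 for all t ∈ (t₁, t_m) and u'(t) > 0 for all t ∈ (t_m, t₂), or (successive minima case) u'(t) > 0 for all t ∈ (t₁, t_m) and u'(t) < 0 for all t ∈ (t_m, t₂). Then in either case u(t₂) < u(t₁). -/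
open Real Set

section Duffing

variable {ε lam : ℝ} {u : ℝ → ℝ}

/-- The energy of the forced Duffing equation, normalized by a height `c`, has derivative
`(u t - c) * sin t` along solutions. -/
lemma hasDerivAt_duffing_energy (hu : ContDiff ℝ 2 u) {t : ℝ}
    (ht : ε ^ 2 * deriv (deriv u) t = u t ^ 3 - lam * u t + Real.cos t) (c : ℝ) :
    HasDerivAt (fun s => ε ^ 2 * deriv u s ^ 2 / 2 - u s ^ 4 / 4 + lam * u s ^ 2 / 2
      - (u s - c) * Real.cos s) ((u t - c) * Real.sin t) t := by
  have hd : HasDerivAt u (deriv u t) t :=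
    (hu.differentiable (by norm_num) t).hasDerivAt
  have hd' : HasDerivAt (deriv u) (deriv (deriv u) t) t :=
    (((contDiff_succ_iff_deriv (n := 1)).1 hu).2.2.differentiable (by norm_num) t).hasDerivAt
  have h := (((((hd'.pow 2).const_mul (ε ^ 2)).div_const 2).sub ((hd.pow 4).div_const 4)).add
    (((hd.pow 2).const_mul lam).div_const 2)).sub ((hd.sub_const c).mul (Real.hasDerivAt_cos t))
  refine h.congr_deriv ?_
  norm_num
  linear_combination deriv u t * ht

/-- Between two times in `[0,π]` at which `u` takes the same value and above which `u` stays,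
the speed increases. -/
lemma duffing_speed_lt_of_above (hu : ContDiff ℝ 2 u)
    (hueq : ∀ t ∈ Icc (0 : ℝ) π,
      ε ^ 2 * deriv (deriv u) t = u t ^ 3 - lam * u t + Real.cos t)
    {a b : ℝ} (ha : 0 ≤ a) (hab : a < b) (hb : b ≤ π) (huab : u a = u b)
    (h : ∀ t ∈ Ioo a b, u a < u t) : deriv u a ^ 2 < deriv u b ^ 2 := by
  have hE : ∀ t ∈ Icc a b, _ := fun t ht =>
    hasDerivAt_duffing_energy hu (hueq t ⟨ha.trans ht.1, ht.2.trans hb⟩) (u a)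
  have hmono := strictMonoOn_of_deriv_pos (convex_Icc a b)
    (fun t ht => (hE t ht).continuousAt.continuousWithinAt) (fun t ht => by
      rw [interior_Icc] at ht
      rw [(hE t (Ioo_subset_Icc_self ht)).deriv]
      exact mul_pos (sub_pos.2 (h t ht))
        (Real.sin_pos_of_pos_of_lt_pi (ha.trans_lt ht.1) (ht.2.trans_le hb)))
  have := hmono (left_mem_Icc.2 hab.le) (right_mem_Icc.2 hab.le) hab
  simp only [← huab] at this
  exact lt_of_mul_lt_mul_left (by linarith) (sq_nonneg ε)

/-- Between two times in `[0,π]` at which `u` takes the same value and below which `u` stays,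
the speed decreases. -/
lemma duffing_speed_lt_of_below (hu : ContDiff ℝ 2 u)
    (hueq : ∀ t ∈ Icc (0 : ℝ) π,
      ε ^ 2 * deriv (deriv u) t = u t ^ 3 - lam * u t + Real.cos t)
    {a b : ℝ} (ha : 0 ≤ a) (hab : a < b) (hb : b ≤ π) (huab : u a = u b)
    (h : ∀ t ∈ Ioo a b, u t < u a) : deriv u b ^ 2 < deriv u a ^ 2 := by
  have hE : ∀ t ∈ Icc a b, _ := fun t ht =>
    hasDerivAt_duffing_energy hu (hueq t ⟨ha.trans ht.1, ht.2.trans hb⟩) (u a)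
  have hanti := strictAntiOn_of_deriv_neg (convex_Icc a b)
    (fun t ht => (hE t ht).continuousAt.continuousWithinAt) (fun t ht => by
      rw [interior_Icc] at ht
      rw [(hE t (Ioo_subset_Icc_self ht)).deriv]
      exact mul_neg_of_neg_of_pos (sub_neg.2 (h t ht))
        (Real.sin_pos_of_pos_of_lt_pi (ha.trans_lt ht.1) (ht.2.trans_le hb)))
  have := hanti (left_mem_Icc.2 hab.le) (right_mem_Icc.2 hab.le) hab
  simp only [← huab] at this
  exact lt_of_mul_lt_mul_left (by linarith) (sq_nonneg ε)

end Duffing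

/-- Monotonicity of successive extrema: if `u` solves the Duffing equation on
`[0,π]` with `u'(0) = 0` and `0 < t₁ < t_m < t₂ < π` are such that `u'` vanishes
at `t₁, t_m, t₂` and `t₁, t₂` are successive maxima (or successive minima) with
intervening extremum `t_m`, then `u(t₂) < u(t₁)`. -/
theorem stmt_15 (ε lam : ℝ) (hε : 0 < ε) (u : ℝ → ℝ)
    (hu : ContDiff ℝ 2 u)
    (hueq : ∀ t ∈ Icc (0 : ℝ) π,
      ε ^ 2 * deriv (deriv u) t = u t ^ 3 - lam * u t + Real.cos t)
    (hu0 : deriv u 0 = 0)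
    (t₁ tm t₂ : ℝ) (h1 : 0 < t₁) (h2 : t₁ < tm) (h3 : tm < t₂) (h4 : t₂ < π)
    (hd1 : deriv u t₁ = 0) (hdm : deriv u tm = 0) (hd2 : deriv u t₂ = 0)
    (hcase :
      ((∀ t ∈ Ioo t₁ tm, deriv u t < 0) ∧ (∀ t ∈ Ioo tm t₂, 0 < deriv u t)) ∨
      ((∀ t ∈ Ioo t₁ tm, 0 < deriv u t) ∧ (∀ t ∈ Ioo tm t₂, deriv u t < 0))) :
    u t₂ < u t₁ := by
  have hc : Continuous u := hu.continuous
  by_contra! hle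
  rcases hcase with ⟨hL, hR⟩ | ⟨hL, hR⟩
  · have hanti : StrictAntiOn u (Icc t₁ tm) :=
      strictAntiOn_of_deriv_neg (convex_Icc _ _) hc.continuousOn (by rwa [interior_Icc])
    have hmono : StrictMonoOn u (Icc tm t₂) :=
      strictMonoOn_of_deriv_pos (convex_Icc _ _) hc.continuousOn (by rwa [interior_Icc])
    have hlt : u tm < u t₁ := hanti (left_mem_Icc.2 h2.le) (right_mem_Icc.2 h2.le) h2
    obtain ⟨s, hs, hus⟩ := intermediate_value_Icc h3.le hc.continuousOn ⟨hlt.le, hle⟩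
    have := duffing_speed_lt_of_below hu hueq h1.le (h2.trans_le hs.1) (hs.2.trans h4.le) hus.symm
      (fun t ht => by
        rcases le_total t tm with h | h
        · exact hanti (left_mem_Icc.2 h2.le) ⟨ht.1.le, h⟩ ht.1
        · exact hus ▸ hmono ⟨h, ht.2.le.trans hs.2⟩ hs ht.2)
    rw [hd1] at this
    nlinarith [sq_nonneg (deriv u s)]
  · have hmono : StrictMonoOn u (Icc t₁ tm) :=
      strictMonoOn_of_deriv_pos (convex_Icc _ _) hc.continuousOn (by rwa [interior_Icc])
    have hanti : StrictAntiOn u (Icc tm t₂) :=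
      strictAntiOn_of_deriv_neg (convex_Icc _ _) hc.continuousOn (by rwa [interior_Icc])
    have hlt : u t₂ < u tm := hanti (left_mem_Icc.2 h3.le) (right_mem_Icc.2 h3.le) h3
    obtain ⟨s, hs, hus⟩ := intermediate_value_Icc h2.le hc.continuousOn ⟨hle, hlt.le⟩
    have := duffing_speed_lt_of_above hu hueq (h1.le.trans hs.1) (hs.2.trans_lt h3) h4.le hus
      (fun t ht => by
        rcases le_total t tm with h | h
        · exact hmono hs ⟨hs.1.trans ht.1.le, h⟩ ht.1
        · exact hus ▸ hanti ⟨h, ht.2.le⟩ (right_mem_Icc.2 h3.le) ht.2)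
    rw [hd2] at this
    nlinarith [sq_nonneg (deriv u s)]
end
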